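/- Let G be an acyclically edge k-critical finite simple graph with k > Δ(G), and let v be a vertex of G of degree 2. Then every neighbor of v has degree at least k − Δ(G) + 3. -/

import Mathlib

open SimpleGraph

/-- A proper edge coloring of `G`: distinct edges sharing a vertex get distinct colors. -/
def IsProperEdgeColoring {V : Type*} {α : Type*} (G : SimpleGraph V) (c : Sym2 V → α) : Prop :=
  ∀ e₁ ∈ G.edgeSet, ∀ e₂ ∈ G.edgeSet, e₁ ≠ e₂ → (∃ v, v ∈ e₁ ∧ v ∈ e₂) → c e₁ ≠ c e₂

/-- An acyclic edge coloring: proper, and no cycle of `G` uses at most two colors. -/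
def IsAcyclicEdgeColoring {V : Type*} {α : Type*} (G : SimpleGraph V) (c : Sym2 V → α) : Prop :=
  IsProperEdgeColoring G c ∧
    ∀ (v : V) (w : G.Walk v v), w.IsCycle →
      ¬ ∃ a b : α, ∀ e ∈ w.edges, c e = a ∨ c e = b

/-- `G` has an acyclic edge coloring with `k` colors. -/
def AcyclicEdgeColorable {V : Type*} (G : SimpleGraph V) (k : ℕ) : Prop :=
  ∃ c : Sym2 V → Fin k, IsAcyclicEdgeColoring G c

/-- The acyclic chromatic index: least `k` such that `G` is acyclically edge `k`-colorable. -/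
noncomputable def acyclicChromaticIndex {V : Type*} (G : SimpleGraph V) : ℕ :=
  sInf {k | AcyclicEdgeColorable G k}

/-- `G` is acyclically edge `k`-critical: `G` is not acyclically edge `k`-colorable, but every
proper subgraph of `G` is. -/
def IsAcyclicallyEdgeCritical {V : Type*} (G : SimpleGraph V) (k : ℕ) : Prop :=
  ¬ AcyclicEdgeColorable G k ∧ ∀ H : SimpleGraph V, H < G → AcyclicEdgeColorable H k

namespace SimpleGraph

variable {V α : Type*}

/-- The spanning subgraph of `G` whose edges are those colored `a` or `b` by `c`. -/
def bicolored (G : SimpleGraph V) (c : Sym2 V → α) (a b : α) : SimpleGraph V where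
  Adj x y := G.Adj x y ∧ (c s(x, y) = a ∨ c s(x, y) = b)
  symm := ⟨fun x y h => by rw [Sym2.eq_swap]; exact ⟨h.1.symm, h.2⟩⟩
  loopless := ⟨fun x h => G.loopless.irrefl x h.1⟩

theorem bicolored_comm (G : SimpleGraph V) (c : Sym2 V → α) (a b : α) :
    G.bicolored c a b = G.bicolored c b a := by
  ext x y
  exact and_congr_right fun _ => or_comm

theorem bicolored_mono {G H : SimpleGraph V} (h : H ≤ G) (c : Sym2 V → α) (a b : α) :
    H.bicolored c a b ≤ G.bicolored c a b :=
  fun _ _ hxy => ⟨h hxy.1, hxy.2⟩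

theorem isProperEdgeColoring_iff {G : SimpleGraph V} {c : Sym2 V → α} :
    IsProperEdgeColoring G c ↔
      ∀ x y z, G.Adj x y → G.Adj x z → c s(x, y) = c s(x, z) → y = z := by
  constructor
  · intro h x y z hy hz hc
    by_contra hne
    exact h s(x, y) hy s(x, z) hz (fun he => hne (Sym2.congr_right.mp he)) ⟨x, by simp, by simp⟩ hc
  · rintro h e₁ h₁ e₂ h₂ hne ⟨x, hx₁, hx₂⟩ hc
    obtain ⟨y, rfl⟩ := hx₁
    obtain ⟨z, rfl⟩ := hx₂
    exact hne (by rw [h x y z h₁ h₂ hc])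

theorem isAcyclicEdgeColoring_iff {G : SimpleGraph V} {c : Sym2 V → α} :
    IsAcyclicEdgeColoring G c ↔
      (∀ x y z, G.Adj x y → G.Adj x z → c s(x, y) = c s(x, z) → y = z) ∧
        ∀ a b, (G.bicolored c a b).IsAcyclic := by
  rw [IsAcyclicEdgeColoring, isProperEdgeColoring_iff]
  refine and_congr_right fun _ => ⟨fun h a b v w hw => ?_, fun h v w hw => ?_⟩
  · have hle : G.bicolored c a b ≤ G := fun _ _ h => h.1
    refine h v (w.mapLe hle) (hw.mapLe hle) ⟨a, b, fun e he => ?_⟩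
    rw [Walk.edges_mapLe_eq_edges] at he
    have := w.edges_subset_edgeSet he
    induction e with | _ x y => exact this.2
  · rintro ⟨a, b, hab⟩
    have hmem : ∀ e ∈ w.edges, e ∈ (G.bicolored c a b).edgeSet := fun e he => by
      have h₁ := w.edges_subset_edgeSet he
      have h₂ := hab e he
      induction e with | _ x y => exact ⟨h₁, h₂⟩
    exact h a b _ (hw.transfer hmem)

theorem Reachable.mem_of_closed {G : SimpleGraph V} {S : Set V} {x y : V}
    (h : G.Reachable x y) (hS : ∀ a ∈ S, ∀ b, G.Adj a b → b ∈ S) (hx : x ∈ S) : y ∈ S := by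
  obtain ⟨w⟩ := h
  induction w with
  | nil => exact hx
  | cons hadj _ ih => exact ih (hS _ hx _ hadj)

theorem Reachable.of_avoiding {G K : SimpleGraph V} {v u y : V} (h : G.Reachable v u)
    (hvu : v ≠ u) (hu : ∀ x, G.Adj u x → x = y)
    (hK : ∀ a b, G.Adj a b → a ≠ u → b ≠ u → K.Adj a b) : K.Reachable v y := by
  by_contra hy
  refine (h.mem_of_closed (S := {x | x ≠ u ∧ K.Reachable v x}) ?_ ⟨hvu, .refl v⟩).1 rfl
  rintro a ⟨hau, hva⟩ b hab
  have hbu : b ≠ u := by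
    rintro rfl
    exact hy (hu a hab.symm ▸ hva)
  exact ⟨hbu, hva.trans (hK a b hab hau hbu).reachable⟩

theorem Walk.IsPath.eq_of_leaves {G : SimpleGraph V}
    (h2 : ∀ x a b d, G.Adj x a → G.Adj x b → G.Adj x d → a = b ∨ a = d ∨ b = d) {a b d z : V}
    {p : G.Walk a b} {q : G.Walk a d} (hp : p.IsPath) (hq : q.IsPath) (hz : G.Adj a z)
    (hzp : z ∉ p.support) (hzq : z ∉ q.support)
    (hb : ∀ x y, G.Adj b x → G.Adj b y → x = y) (hd : ∀ x y, G.Adj d x → G.Adj d y → x = y) :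
    b = d := by
  induction p generalizing z with
  | nil =>
    cases q with
    | nil => rfl
    | cons hadj q => exact absurd (hb _ _ hz hadj) (by rintro rfl; simp at hzq)
  | cons hadj p ih =>
    cases q with
    | nil => exact absurd (hd _ _ hz hadj) (by rintro rfl; simp at hzp)
    | cons hadj' q =>
      have hzp' := fun h => hzp (List.mem_cons_of_mem _ h)
      rcases h2 _ _ _ _ hz hadj hadj' with rfl | rfl | rfl
      · simp at hzp
      · simp at hzq
      · rw [Walk.cons_isPath_iff] at hp hq
        exact ih hp.1 hq.1 hadj.symm hp.2 hq.2 hb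

/-- In a graph of maximum degree at most two, a component has at most two leaves. -/
theorem eq_of_reachable_leaves {G : SimpleGraph V}
    (h2 : ∀ x a b d, G.Adj x a → G.Adj x b → G.Adj x d → a = b ∨ a = d ∨ b = d) {a b d : V}
    (hab : G.Reachable a b) (had : G.Reachable a d) (hneb : a ≠ b) (hned : a ≠ d)
    (ha : ∀ x y, G.Adj a x → G.Adj a y → x = y)
    (hb : ∀ x y, G.Adj b x → G.Adj b y → x = y) (hd : ∀ x y, G.Adj d x → G.Adj d y → x = y) :
    b = d := by
  obtain ⟨p, hp⟩ := hab.exists_isPath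
  obtain ⟨q, hq⟩ := had.exists_isPath
  cases p with
  | nil => exact absurd rfl hneb
  | cons hadj p =>
    cases q with
    | nil => exact absurd rfl hned
    | cons hadj' q =>
      obtain rfl := ha _ _ hadj hadj'
      rw [Walk.cons_isPath_iff] at hp hq
      exact hp.1.eq_of_leaves h2 hq.1 hadj.symm hp.2 hq.2 hb hd


theorem isAcyclicEdgeColoring_mono {G H : SimpleGraph V} {c : Sym2 V → α} (hle : H ≤ G)
    (hc : IsAcyclicEdgeColoring G c) : IsAcyclicEdgeColoring H c := by
  rw [isAcyclicEdgeColoring_iff] at hc ⊢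
  exact ⟨fun x y z hy hz => hc.1 x y z (hle hy) (hle hz),
    fun a b => (hc.2 a b).anti (bicolored_mono hle c a b)⟩

/-- An acyclic edge coloring extends to one more edge `xy`, with a color `a` missing at both ends,
if no bichromatic walk using `a` joins `x` to `y`. -/
theorem isAcyclicEdgeColoring_update [DecidableEq V] {G G' : SimpleGraph V} {c : Sym2 V → α}
    {x y : V} {a : α} (hc : IsAcyclicEdgeColoring G c) (hxy : x ≠ y)
    (hG' : ∀ p q, G'.Adj p q → G.Adj p q ∨ s(p, q) = s(x, y))
    (hx : ∀ z, G.Adj x z → c s(x, z) ≠ a) (hy : ∀ z, G.Adj y z → c s(y, z) ≠ a)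
    (hr : ∀ b, ¬ (G.bicolored c a b).Reachable x y) :
    IsAcyclicEdgeColoring G' (Function.update c s(x, y) a) := by
  rw [isAcyclicEdgeColoring_iff] at hc ⊢
  refine ⟨fun p q r hq hr' he => ?_, fun p q => ?_⟩
  · rcases eq_or_ne s(p, q) s(x, y) with h₁ | h₁ <;> rcases eq_or_ne s(p, r) s(x, y) with h₂ | h₂
    · exact Sym2.congr_right.mp (h₁.trans h₂.symm)
    · have h₃ := (hG' _ _ hr').resolve_right h₂
      rw [h₁, Function.update_self, Function.update_of_ne h₂] at he
      rcases Sym2.eq_iff.mp h₁ with ⟨rfl, -⟩ | ⟨rfl, -⟩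
      · exact absurd he.symm (hx _ h₃)
      · exact absurd he.symm (hy _ h₃)
    · have h₃ := (hG' _ _ hq).resolve_right h₁
      rw [h₂, Function.update_self, Function.update_of_ne h₁] at he
      rcases Sym2.eq_iff.mp h₂ with ⟨rfl, -⟩ | ⟨rfl, -⟩
      · exact absurd he (hx _ h₃)
      · exact absurd he (hy _ h₃)
    · rw [Function.update_of_ne h₁, Function.update_of_ne h₂] at he
      exact hc.1 p q r ((hG' _ _ hq).resolve_right h₁) ((hG' _ _ hr').resolve_right h₂) he
  · by_cases hpq : p = a ∨ q = a
    · have hnr : ¬ (G.bicolored c p q).Reachable x y := by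
        rcases hpq with rfl | rfl
        · exact hr q
        · exact bicolored_comm G c q p ▸ hr p
      refine ((hc.2 p q).sup_edge_of_not_reachable hnr).anti fun s t h => ?_
      rw [sup_adj]
      by_cases hst : s(s, t) = s(x, y)
      · exact Or.inr ((edge_adj ..).mpr ⟨Sym2.eq_iff.mp hst, h.1.ne⟩)
      · have h₂ := h.2
        rw [Function.update_of_ne hst] at h₂
        exact Or.inl ⟨(hG' _ _ h.1).resolve_right hst, h₂⟩
    · refine (hc.2 p q).anti fun s t h => ?_
      have h₂ := h.2
      have hst : s(s, t) ≠ s(x, y) := by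
        intro hst
        rw [hst, Function.update_self] at h₂
        exact hpq (h₂.imp Eq.symm Eq.symm)
      rw [Function.update_of_ne hst] at h₂
      exact ⟨(hG' _ _ h.1).resolve_right hst, h₂⟩

theorem isAcyclicEdgeColoring_update_of_disjoint [DecidableEq V] {G G' : SimpleGraph V}
    {c : Sym2 V → α} {x y : V} {a : α} (hc : IsAcyclicEdgeColoring G c) (hxy : x ≠ y)
    (hG' : ∀ p q, G'.Adj p q → G.Adj p q ∨ s(p, q) = s(x, y))
    (hx : ∀ z, G.Adj x z → c s(x, z) ≠ a) (hy : ∀ z, G.Adj y z → c s(y, z) ≠ a)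
    (hd : ∀ z t, G.Adj x z → G.Adj y t → c s(x, z) ≠ c s(y, t)) :
    IsAcyclicEdgeColoring G' (Function.update c s(x, y) a) := by
  refine isAcyclicEdgeColoring_update hc hxy hG' hx hy fun b hr => ?_
  by_cases hex : ∃ z, (G.bicolored c a b).Adj x z
  · obtain ⟨z, hz⟩ := hex
    have hzb := hz.2.resolve_left (hx z hz.1)
    refine hxy (hr.symm.mem_of_closed (S := {y}) ?_ rfl)
    rintro _ rfl t ht
    exact absurd (hzb.trans (ht.2.resolve_left (hy t ht.1)).symm) (hd z t hz.1 ht.1)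
  · refine hxy (hr.mem_of_closed (S := {x}) ?_ rfl).symm
    rintro _ rfl t ht
    exact absurd ⟨t, ht⟩ hex

/-- The colors of two edges `uy₁` and `uy₂` can be swapped if `y₁` and `y₂` share no further
color with `u`. -/
theorem isAcyclicEdgeColoring_swap [DecidableEq V] {H : SimpleGraph V} {c : Sym2 V → α}
    {u y₁ y₂ : V} (hc : IsAcyclicEdgeColoring H c) (h₁ : H.Adj u y₁) (h₂ : H.Adj u y₂)
    (hne : y₁ ≠ y₂)
    (hd₁ : ∀ z t, H.Adj u z → H.Adj y₁ t → c s(u, z) = c s(y₁, t) → t = u)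
    (hd₂ : ∀ z t, H.Adj u z → H.Adj y₂ t → c s(u, z) = c s(y₂, t) → t = u) :
    IsAcyclicEdgeColoring H
      (Function.update (Function.update c s(u, y₁) (c s(u, y₂))) s(u, y₂) (c s(u, y₁))) := by
  have hp := (isAcyclicEdgeColoring_iff.mp hc).1
  have hs {z t : V} (h : z ≠ t) : s(u, z) ≠ s(u, t) := fun he => h (Sym2.congr_right.mp he)
  have hs' (t : V) : s(y₂, t) ≠ s(u, y₁) := by
    intro he
    rcases Sym2.eq_iff.mp he with ⟨h, -⟩ | ⟨h, -⟩
    · exact h₂.ne h.symm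
    · exact hne h.symm
  have hstep : IsAcyclicEdgeColoring (H.deleteEdges {s(u, y₂)})
      (Function.update c s(u, y₁) (c s(u, y₂))) := by
    refine isAcyclicEdgeColoring_update_of_disjoint
      (G := H.deleteEdges {s(u, y₁), s(u, y₂)})
      (isAcyclicEdgeColoring_mono (deleteEdges_le _) hc) h₁.ne ?_ ?_ ?_ ?_
    · intro p q h
      simp only [deleteEdges_adj, Set.mem_singleton_iff, Set.mem_insert_iff, not_or] at h ⊢
      tauto
    · intro z hz he
      simp only [deleteEdges_adj, Set.mem_singleton_iff, Set.mem_insert_iff, not_or] at hz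
      exact hz.2.2 (by rw [hp u z y₂ hz.1 h₂ he])
    · intro t ht he
      simp only [deleteEdges_adj, Set.mem_singleton_iff, Set.mem_insert_iff, not_or] at ht
      exact ht.2.1 (by rw [hd₁ y₂ t h₂ ht.1 he.symm, Sym2.eq_swap])
    · intro z t hz ht he
      simp only [deleteEdges_adj, Set.mem_singleton_iff, Set.mem_insert_iff, not_or] at hz ht
      exact ht.2.1 (by rw [hd₁ z t hz.1 ht.1 he, Sym2.eq_swap])
  refine isAcyclicEdgeColoring_update_of_disjoint hstep h₂.ne ?_ ?_ ?_ ?_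
  · intro p q h
    simp only [deleteEdges_adj, Set.mem_singleton_iff]
    tauto
  · intro z hz he
    simp only [deleteEdges_adj, Set.mem_singleton_iff] at hz
    rcases eq_or_ne z y₁ with rfl | hzy
    · rw [Function.update_self] at he
      exact hne (hp u z y₂ h₁ h₂ he.symm)
    · rw [Function.update_of_ne (hs hzy)] at he
      exact hzy (hp u z y₁ hz.1 h₁ he)
  · intro t ht he
    simp only [deleteEdges_adj, Set.mem_singleton_iff] at ht
    rw [Function.update_of_ne (hs' t)] at he
    exact ht.2 (by rw [hd₂ y₁ t h₁ ht.1 he.symm, Sym2.eq_swap])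
  · intro z t hz ht he
    simp only [deleteEdges_adj, Set.mem_singleton_iff] at hz ht
    rw [Function.update_of_ne (hs' t)] at he
    refine ht.2 ?_
    rcases eq_or_ne z y₁ with rfl | hzy
    · rw [Function.update_self] at he
      rw [hd₂ y₂ t h₂ ht.1 he, Sym2.eq_swap]
    · rw [Function.update_of_ne (hs hzy)] at he
      rw [hd₂ z t hz.1 ht.1 he, Sym2.eq_swap]

section Pendant

variable {G H : SimpleGraph V} {c : Sym2 V → α} {v u w : V} {a : α}

/-- If `v` is a leaf of `H` attached to `w`, and no coloring of `H` extends to the edge `vu`, then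
each color missing at `u` gives a bichromatic walk from `v` to `u`. -/
theorem reachable_bicolored_of_not_colorable
    (hG : ∀ c : Sym2 V → α, ¬ IsAcyclicEdgeColoring G c)
    (hGH : ∀ p q, G.Adj p q → H.Adj p q ∨ s(p, q) = s(v, u)) (hv : ∀ x, H.Adj v x → x = w)
    (hvu : v ≠ u) (hc : IsAcyclicEdgeColoring H c) (ha : ∀ y, H.Adj u y → c s(u, y) ≠ a)
    (hav : a ≠ c s(v, w)) : (H.bicolored c (c s(v, w)) a).Reachable v u := by
  classical
  by_contra hnr
  refine hG _ (isAcyclicEdgeColoring_update hc hvu hGH ?_ ha fun b hr => ?_)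
  · intro z hz
    rw [hv z hz]
    exact hav.symm
  · rcases eq_or_ne b (c s(v, w)) with rfl | hb
    · exact hnr (bicolored_comm H c _ _ ▸ hr)
    · refine hvu (hr.mem_of_closed (S := {v}) ?_ rfl).symm
      rintro _ rfl t ht
      obtain rfl := hv t ht.1
      rcases ht.2 with h | h
      · exact absurd h.symm hav
      · exact absurd h.symm hb

theorem exists_color_eq_of_not_colorable
    (hG : ∀ c : Sym2 V → α, ¬ IsAcyclicEdgeColoring G c)
    (hGH : ∀ p q, G.Adj p q → H.Adj p q ∨ s(p, q) = s(v, u)) (hv : ∀ x, H.Adj v x → x = w)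
    (hvu : v ≠ u) (hc : IsAcyclicEdgeColoring H c) (ha : ∀ y, H.Adj u y → c s(u, y) ≠ a)
    (hav : a ≠ c s(v, w)) : ∃ y, H.Adj u y ∧ c s(u, y) = c s(v, w) := by
  by_contra! hno
  have hr := reachable_bicolored_of_not_colorable hG hGH hv hvu hc ha hav
  refine hvu (hr.symm.mem_of_closed (S := {u}) ?_ rfl)
  rintro _ rfl t ht
  rcases ht.2 with h | h
  · exact absurd h (hno t ht.1)
  · exact absurd h (ha t ht.1)

theorem exists_adj_colored_of_reachable_bicolored {b : α} {x y : V}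
    (hp : ∀ x y z, H.Adj x y → H.Adj x z → c s(x, y) = c s(x, z) → y = z)
    (hx : ∀ z, (H.bicolored c b a).Adj x z → z = w) (hxw : H.Adj x w) (hb : c s(x, w) = b)
    (hyx : y ≠ x) (hyw : y ≠ w) (hr : (H.bicolored c b a).Reachable x y) :
    ∃ z, H.Adj w z ∧ c s(w, z) = a := by
  by_contra! hno
  have := hr.mem_of_closed (S := {x, w}) ?_ (by simp)
  · rcases this with h | h
    · exact hyx h
    · exact hyw h
  · rintro p (rfl | hpw) t ht
    · exact Or.inr (hx t ht)
    · obtain rfl : p = w := hpw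
      rcases ht.2 with h | h
      · exact Or.inl (hp p t x ht.1 hxw.symm (by rw [h, Sym2.eq_swap, hb]))
      · exact absurd h (hno t ht.1)

end Pendant

end SimpleGraph

theorem stmt9 {V : Type*} [Fintype V] (G : SimpleGraph V) [DecidableRel G.Adj]
    (k : ℕ) (hG : IsAcyclicallyEdgeCritical G k) (hk : G.maxDegree < k)
    (v : V) (hv : G.degree v = 2) :
    ∀ u : V, G.Adj v u → k - G.maxDegree + 3 ≤ G.degree u := by
  classical
  intro u hu
  by_contra! hlt
  obtain ⟨w, hwu, hvw, hvn⟩ : ∃ w, w ≠ u ∧ G.Adj v w ∧ ∀ x, G.Adj v x → x = u ∨ x = w := by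
    obtain ⟨p, q, hpq, hN⟩ := Finset.card_eq_two.mp hv
    have hmem (x : V) : G.Adj v x ↔ x = p ∨ x = q := by
      rw [← mem_neighborFinset, hN]
      simp
    rcases (hmem u).mp hu with rfl | rfl
    · exact ⟨q, hpq.symm, (hmem q).mpr (Or.inr rfl), fun x hx => (hmem x).mp hx⟩
    · exact ⟨p, hpq, (hmem p).mpr (Or.inl rfl), fun x hx => ((hmem x).mp hx).symm⟩
  obtain ⟨H, hH⟩ : ∃ H, H = G.deleteEdges {s(v, u)} := ⟨_, rfl⟩
  have hadj (x y : V) : H.Adj x y ↔ G.Adj x y ∧ s(x, y) ≠ s(v, u) := by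
    rw [hH, deleteEdges_adj, Set.mem_singleton_iff]
  have hle : H ≤ G := fun x y h => ((hadj x y).mp h).1
  have hlt' : H < G := lt_of_le_not_ge hle fun h => ((hadj v u).mp (h hu)).2 rfl
  have hGH (p q : V) (h : G.Adj p q) : H.Adj p q ∨ s(p, q) = s(v, u) := by
    rw [hadj]
    tauto
  have hHvu : ¬ H.Adj v u := fun h => ((hadj v u).mp h).2 rfl
  have hHvw : H.Adj v w := (hadj v w).mpr ⟨hvw, fun h => hwu (Sym2.congr_right.mp h)⟩
  have hHv (x : V) (h : H.Adj v x) : x = w := by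
    refine (hvn x (hle h)).resolve_left ?_
    rintro rfl
    exact hHvu h
  have hno (c : Sym2 V → Fin k) : ¬ IsAcyclicEdgeColoring G c := fun h => hG.1 ⟨c, h⟩
  obtain ⟨c, hc⟩ := hG.2 H hlt'
  let C (c : Sym2 V → Fin k) (x : V) : Finset (Fin k) :=
    Finset.univ.filter fun a => ∃ y, H.Adj x y ∧ c s(x, y) = a
  have hC (c : Sym2 V → Fin k) (x : V) (a : Fin k) :
      a ∈ C c x ↔ ∃ y, H.Adj x y ∧ c s(x, y) = a := by simp [C]
  have hCcard (c : Sym2 V → Fin k) (x : V) : (C c x).card ≤ G.maxDegree := by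
    refine le_trans ?_ (G.degree_le_maxDegree x)
    refine le_trans (Finset.card_le_card fun a ha => ?_)
      (Finset.card_image_le (s := G.neighborFinset x) (f := fun y => c s(x, y)))
    obtain ⟨y, hy, rfl⟩ := (hC c x a).mp ha
    exact Finset.mem_image_of_mem _ ((G.mem_neighborFinset x y).mpr (hle hy))
  have hCu (c : Sym2 V → Fin k) : (C c u).card + 1 ≤ G.degree u := by
    have h₁ : (C c u).card ≤ ((G.neighborFinset u).erase v).card := by
      refine le_trans (Finset.card_le_card fun a ha => ?_)
        (Finset.card_image_le (f := fun y => c s(u, y)))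
      obtain ⟨y, hy, rfl⟩ := (hC c u a).mp ha
      refine Finset.mem_image_of_mem _ (Finset.mem_erase.mpr
        ⟨?_, (G.mem_neighborFinset u y).mpr (hle hy)⟩)
      rintro rfl
      exact hHvu hy.symm
    have h₂ := Finset.card_erase_add_one ((G.mem_neighborFinset u v).mpr hu.symm)
    rw [card_neighborFinset_eq_degree] at h₂
    omega
  have hshare (c : Sym2 V → Fin k) (hc : IsAcyclicEdgeColoring H c) :
      ∃ y, H.Adj u y ∧ c s(u, y) = c s(v, w) := by
    obtain ⟨a, ha⟩ : ∃ a, a ∉ insert (c s(v, w)) (C c u) := by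
      by_contra! hall
      have h₁ := Finset.card_insert_le (c s(v, w)) (C c u)
      rw [Finset.eq_univ_of_forall hall, Finset.card_univ, Fintype.card_fin] at h₁
      have := hCu c
      have := G.degree_le_maxDegree u
      omega
    rw [Finset.mem_insert, not_or, hC] at ha
    exact exists_color_eq_of_not_colorable hno hGH hHv hu.ne hc
      (fun y hy he => ha.2 ⟨y, hy, he⟩) ha.1
  have hreach (c : Sym2 V → Fin k) (hc : IsAcyclicEdgeColoring H c) (a : Fin k)
      (ha : a ∉ C c u) : a ≠ c s(v, w) ∧ (H.bicolored c (c s(v, w)) a).Reachable v u := by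
    have hav : a ≠ c s(v, w) := by
      rintro rfl
      exact ha ((hC _ _ _).mpr (hshare c hc))
    exact ⟨hav, reachable_bicolored_of_not_colorable hno hGH hHv hu.ne hc
      (fun y hy he => ha ((hC _ _ _).mpr ⟨y, hy, he⟩)) hav⟩
  have hleft (c : Sym2 V → Fin k) (hc : IsAcyclicEdgeColoring H c) (a : Fin k)
      (ha : a ∉ C c u) : a ∈ C c w :=
    (hC _ _ _).mpr (exists_adj_colored_of_reachable_bicolored (isAcyclicEdgeColoring_iff.mp hc).1
      (fun z hz => hHv z hz.1) hHvw rfl hu.ne' hwu.symm (hreach c hc a ha).2)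
  have hright (c : Sym2 V → Fin k) (hc : IsAcyclicEdgeColoring H c) (a : Fin k)
      (ha : a ∉ C c u) (y : V) (hy : H.Adj u y) (hyc : c s(u, y) = c s(v, w)) : a ∈ C c y := by
    have hp := (isAcyclicEdgeColoring_iff.mp hc).1
    refine (hC _ _ _).mpr (exists_adj_colored_of_reachable_bicolored hp
      (fun z hz => ?_) hy hyc hu.ne ?_ (hreach c hc a ha).2.symm)
    · rcases hz.2 with h | h
      · exact hp u z y hz.1 hy (h.trans hyc.symm)
      · exact absurd ((hC _ _ _).mpr ⟨z, hz.1, h⟩) ha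
    · rintro rfl
      exact hHvu hy.symm
  have hp := (isAcyclicEdgeColoring_iff.mp hc).1
  have hrecolor (b : Fin k) (hb : b ∉ C c w) :
      IsAcyclicEdgeColoring H (Function.update c s(v, w) b) := by
    have hiso (z : V) : ¬ (H.deleteEdges {s(v, w)}).Adj v z := by
      rw [deleteEdges_adj, Set.mem_singleton_iff]
      rintro ⟨h, hne⟩
      exact hne (by rw [hHv z h])
    refine isAcyclicEdgeColoring_update_of_disjoint
      (isAcyclicEdgeColoring_mono (deleteEdges_le {s(v, w)}) hc) hvw.ne (fun p q h => ?_)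
      (fun z hz => absurd hz (hiso z)) (fun z hz he => hb ((hC _ _ _).mpr ⟨z, hz.1, he⟩))
      (fun z t hz => absurd hz (hiso z))
    rw [deleteEdges_adj, Set.mem_singleton_iff]
    tauto
  have hne_vw {x y : V} (hx : x ≠ v) (hx' : x ≠ w) : s(x, y) ≠ s(v, w) := by
    intro h
    rcases Sym2.eq_iff.mp h with ⟨h, -⟩ | ⟨h, -⟩
    · exact hx h
    · exact hx' h
  have hCu_recolor (b : Fin k) : C (Function.update c s(v, w) b) u = C c u := by
    ext a
    simp only [hC, Function.update_of_ne (hne_vw hu.ne' hwu.symm)]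
  have hM (b : Fin k) (hb : b ∉ C c w) : b ∈ C c u := by
    obtain ⟨y, hy, hyc⟩ := hshare _ (hrecolor b hb)
    rw [Function.update_self] at hyc
    rw [← hCu_recolor b]
    exact (hC _ _ _).mpr ⟨y, hy, hyc⟩
  have hmissing (y : V) (hy : H.Adj u y) (hyc : c s(u, y) = c s(v, w) ∨ c s(u, y) ∉ C c w)
      (a : Fin k) (ha : a ∉ C c u) : a ∈ C c y := by
    rcases hyc with hyc | hyc
    · exact hright c hc a ha y hy hyc
    · have hyw : y ≠ w := by
        rintro rfl
        exact hyc ((hC _ _ _).mpr ⟨u, hy.symm, by rw [Sym2.eq_swap]⟩)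
      have hyv : y ≠ v := by
        rintro rfl
        exact hHvu hy.symm
      have := hright _ (hrecolor _ hyc) a (by rwa [hCu_recolor]) y hy
        (by rw [Function.update_self, Function.update_of_ne (hne_vw hu.ne' hwu.symm)])
      rw [hC] at this ⊢
      simpa only [Function.update_of_ne (hne_vw hyv hyw)] using this
  have hcw : c s(v, w) ∉ (C c w)ᶜ := by
    rw [Finset.mem_compl, not_not, hC]
    exact ⟨v, hHvw.symm, by rw [Sym2.eq_swap]⟩
  have hsub : insert (c s(v, w)) (C c w)ᶜ ⊆ C c u := by
    intro b hb
    rcases Finset.mem_insert.mp hb with rfl | hb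
    · exact (hC _ _ _).mpr (hshare c hc)
    · exact hM b (Finset.mem_compl.mp hb)
  have hcard : k - G.maxDegree + 1 ≤ (insert (c s(v, w)) (C c w)ᶜ).card := by
    rw [Finset.card_insert_of_notMem hcw, Finset.card_compl, Fintype.card_fin]
    have := hCcard c w
    omega
  have hCu_le := hCu c
  have hCu_eq : insert (c s(v, w)) (C c w)ᶜ = C c u :=
    Finset.eq_of_subset_of_card_le hsub (by omega)
  have hCu_card : (C c u).card = k - G.maxDegree + 1 := by
    rw [hCu_eq] at hcard
    omega
  have hΔ := G.degree_le_maxDegree v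
  have hout : ((C c u)ᶜ).card + 1 = G.maxDegree := by
    rw [Finset.card_compl, Fintype.card_fin]
    omega
  have hshared (y : V) (hy : H.Adj u y) (z t : V) (hz : H.Adj u z) (ht : H.Adj y t)
      (he : c s(u, z) = c s(y, t)) : t = u := by
    have hyC : c s(u, y) ∈ C c u := (hC _ _ _).mpr ⟨y, hy, rfl⟩
    have hyC' : c s(u, y) = c s(v, w) ∨ c s(u, y) ∉ C c w := by
      rwa [← hCu_eq, Finset.mem_insert, Finset.mem_compl] at hyC
    have hsub : insert (c s(u, y)) (C c u)ᶜ ⊆ C c y := by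
      intro b hb
      rcases Finset.mem_insert.mp hb with rfl | hb
      · exact (hC _ _ _).mpr ⟨u, hy.symm, by rw [Sym2.eq_swap]⟩
      · exact hmissing y hy hyC' b (Finset.mem_compl.mp hb)
    have heq := Finset.eq_of_subset_of_card_le hsub (by
      rw [Finset.card_insert_of_notMem (by simpa using hyC), hout]
      exact hCcard c y)
    have htC : c s(y, t) ∈ insert (c s(u, y)) (C c u)ᶜ := by
      rw [heq]
      exact (hC _ _ _).mpr ⟨t, ht, rfl⟩
    rcases Finset.mem_insert.mp htC with h | h
    · exact hp y t u ht hy.symm (by rw [h, Sym2.eq_swap])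
    · exact absurd ((hC _ _ _).mpr ⟨z, hz, he⟩) (Finset.mem_compl.mp h)
  obtain ⟨y₁, hy₁, hc₁⟩ := hshare c hc
  obtain ⟨b, hb, hb'⟩ := Finset.exists_mem_ne (s := C c u) (by omega) (c s(v, w))
  obtain ⟨y₂, hy₂, rfl⟩ := (hC _ _ _).mp hb
  obtain ⟨a, ha⟩ : ((C c u)ᶜ).Nonempty := Finset.card_pos.mp (by omega)
  rw [Finset.mem_compl] at ha
  have hau (z : V) (hz : H.Adj u z) : c s(u, z) ≠ a := fun h => ha ((hC _ _ _).mpr ⟨z, hz, h⟩)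
  have hy₁₂ : y₁ ≠ y₂ := by
    rintro rfl
    exact hb' hc₁
  have hc' := isAcyclicEdgeColoring_swap hc hy₁ hy₂ hy₁₂ (hshared y₁ hy₁) (hshared y₂ hy₂)
  obtain ⟨c', hc'_eq⟩ : ∃ c', c' = Function.update (Function.update c s(u, y₁) (c s(u, y₂)))
    s(u, y₂) (c s(u, y₁)) := ⟨_, rfl⟩
  rw [← hc'_eq] at hc'
  have hc'₁ : c' s(u, y₁) = c s(u, y₂) := by
    rw [hc'_eq, Function.update_of_ne (fun h => hy₁₂ (Sym2.congr_right.mp h)),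
      Function.update_self]
  have hc'₂ : c' s(u, y₂) = c s(u, y₁) := by rw [hc'_eq, Function.update_self]
  have hc'_u (z : V) (h₁ : z ≠ y₁) (h₂ : z ≠ y₂) : c' s(u, z) = c s(u, z) := by
    rw [hc'_eq, Function.update_of_ne (fun h => h₂ (Sym2.congr_right.mp h)),
      Function.update_of_ne (fun h => h₁ (Sym2.congr_right.mp h))]
  have hc'_ne (x z : V) (hx : x ≠ u) (hz : z ≠ u) : c' s(x, z) = c s(x, z) := by
    have hne (y : V) : s(x, z) ≠ s(u, y) := by
      intro h
      rcases Sym2.eq_iff.mp h with ⟨h, -⟩ | ⟨-, h⟩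
      · exact hx h
      · exact hz h
    rw [hc'_eq, Function.update_of_ne (hne _), Function.update_of_ne (hne _)]
  have ha' : a ∉ C c' u := by
    rw [hC]
    rintro ⟨z, hz, he⟩
    by_cases h₁ : z = y₁
    · rw [h₁, hc'₁] at he
      exact hau y₂ hy₂ he
    by_cases h₂ : z = y₂
    · rw [h₂, hc'₂] at he
      exact hau y₁ hy₁ he
    rw [hc'_u z h₁ h₂] at he
    exact hau z hz he
  have hr := (hreach c hc a ha).2
  have hr' := (hreach c' hc' a ha').2
  rw [hc'_ne v w hu.ne hwu] at hr'
  have hp' := (isAcyclicEdgeColoring_iff.mp hc').1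
  let K := (H.bicolored c (c s(v, w)) a).deleteIncidenceSet u
  have hK (x z : V) : K.Adj x z ↔
      (H.Adj x z ∧ (c s(x, z) = c s(v, w) ∨ c s(x, z) = a)) ∧ x ≠ u ∧ z ≠ u :=
    deleteIncidenceSet_adj
  have hK₁ : K.Reachable v y₁ := by
    refine hr.of_avoiding hu.ne (fun x hx => ?_) fun p q h hpu hqu => (hK p q).mpr ⟨h, hpu, hqu⟩
    exact hp u x y₁ hx.1 hy₁ ((hx.2.resolve_right (hau x hx.1)).trans hc₁.symm)
  have hK₂ : K.Reachable v y₂ := by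
    refine hr'.of_avoiding hu.ne (fun x hx => ?_) fun p q h hpu hqu => (hK p q).mpr ?_
    · have hxc := hx.2.resolve_right fun h => ha' ((hC _ _ _).mpr ⟨x, hx.1, h⟩)
      exact hp' u x y₂ hx.1 hy₂ (by rw [hxc, hc'₂, hc₁])
    · obtain ⟨h₁, h₂⟩ := h
      rw [hc'_ne p q hpu hqu] at h₂
      exact ⟨⟨h₁, h₂⟩, hpu, hqu⟩
  have hleaf (y : V) (hy : H.Adj u y) (p q : V) (h₁ : K.Adj y p) (h₂ : K.Adj y q) : p = q := by
    have hcol (t : V) (h : K.Adj y t) : c s(y, t) = a := by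
      rw [hK] at h
      exact h.1.2.resolve_left fun he => h.2.2 (hshared y hy y₁ t hy₁ h.1.1 (hc₁.trans he.symm))
    exact hp y p q ((hK y p).mp h₁).1.1 ((hK y q).mp h₂).1.1 ((hcol p h₁).trans (hcol q h₂).symm)
  have hv_ne (y : V) (hy : H.Adj u y) : v ≠ y := by
    rintro rfl
    exact hHvu hy.symm
  refine hy₁₂ (eq_of_reachable_leaves ?_ hK₁ hK₂ (hv_ne _ hy₁) (hv_ne _ hy₂) ?_ (hleaf y₁ hy₁)
    (hleaf y₂ hy₂))
  · intro x p q r hxp hxq hxr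
    rw [hK] at hxp hxq hxr
    have hpq := hp x p q hxp.1.1 hxq.1.1
    have hpr := hp x p r hxp.1.1 hxr.1.1
    have hqr := hp x q r hxq.1.1 hxr.1.1
    have h₁ := hxp.1.2
    have h₂ := hxq.1.2
    have h₃ := hxr.1.2
    grind
  · intro x y hx hy
    rw [hHv x ((hK v x).mp hx).1.1, hHv y ((hK v y).mp hy).1.1]
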